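/- For every complex q with |q| < 1, the generating function of the number of Rascoe partitions satisfies ∑_{N=1}^{∞} a(N) q^N = ∑_{n=1}^{∞} q^{n(n+1)/2} ∑_{m=1}^{n} [n-1 choose m-1]_q · q^{m(m-1)} / (q;q)_{m-1}. -/

import Mathlib

open scoped BigOperators

/-- The finite q-Pochhammer symbol `(a;q)_n`. -/
noncomputable def qPoch (a q : ℂ) (n : ℕ) : ℂ := ∏ k ∈ Finset.range n, (1 - a * q ^ k)

/-- The Gaussian binomial coefficient `[N choose n]_q`. -/
noncomputable def qbinom (q : ℂ) (N n : ℕ) : ℂ :=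
  if n ≤ N then qPoch q q N / (qPoch q q n * qPoch q q (N - n)) else 0

/-- `a N` is the number of Rascoe partitions of `N`: partitions into distinct parts in
which the number of parts is itself a part. -/
noncomputable def rascoeA (N : ℕ) : ℕ :=
  Nat.card {p : Nat.Partition N // p.parts.Nodup ∧ Multiset.card p.parts ∈ p.parts}

lemma one_sub_pow_succ_ne_zero {q : ℂ} (hq : ‖q‖ < 1) (k : ℕ) : 1 - q * q ^ k ≠ 0 := by
  intro h
  have h1 : q ^ (k + 1) = 1 := by rw [pow_succ']; exact (sub_eq_zero.mp h).symm
  have h2 : ‖q‖ ^ (k + 1) = 1 := by rw [← norm_pow, h1, norm_one]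
  exact (pow_lt_one₀ (norm_nonneg q) hq k.succ_ne_zero).ne h2

lemma qPoch_ne_zero {q : ℂ} (hq : ‖q‖ < 1) (n : ℕ) : qPoch q q n ≠ 0 :=
  Finset.prod_ne_zero_iff.mpr fun k _ => one_sub_pow_succ_ne_zero hq k

lemma qPoch_succ (a q : ℂ) (n : ℕ) : qPoch a q (n + 1) = qPoch a q n * (1 - a * q ^ n) :=
  Finset.prod_range_succ _ _

lemma qbinom_zero_right {q : ℂ} (hq : ‖q‖ < 1) (n : ℕ) : qbinom q n 0 = 1 := by
  have h := qPoch_ne_zero hq n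
  have h0 : qPoch q q 0 = 1 := by simp [qPoch]
  simp [qbinom, h0, h]

lemma qbinom_symm (q : ℂ) {n j : ℕ} (h : j ≤ n) : qbinom q n (n - j) = qbinom q n j := by
  simp only [qbinom, Nat.sub_le, h, if_true, Nat.sub_sub_self h, mul_comm]

/-- The `q`-Pascal rule. -/
lemma qbinom_succ_succ {q : ℂ} (hq : ‖q‖ < 1) {n i : ℕ} (hi : i ≤ n) :
    qbinom q (n + 1) (i + 1) = qbinom q n (i + 1) + q ^ (n - i) * qbinom q n i := by
  obtain ⟨d, rfl⟩ := Nat.exists_eq_add_of_le hi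
  rcases d with _ | d
  · have h1 := qPoch_ne_zero hq i
    have h2 := qPoch_ne_zero hq (i + 1)
    have h0 : qPoch q q 0 = 1 := by simp [qPoch]
    simp [qbinom, h0, h1, h2]
  · have e1 : i + (d + 1) + 1 - (i + 1) = d + 1 := by omega
    have e2 : i + (d + 1) - (i + 1) = d := by omega
    have e3 : i + (d + 1) - i = d + 1 := by omega
    have l1 : i + 1 ≤ i + (d + 1) + 1 := by omega
    have l2 : i + 1 ≤ i + (d + 1) := by omega
    have l3 : i ≤ i + (d + 1) := by omega
    simp only [qbinom, e1, e2, e3, l1, l2, l3, if_true, qPoch_succ]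
    have h1 := qPoch_ne_zero hq i
    have h2 := qPoch_ne_zero hq d
    have h3 := one_sub_pow_succ_ne_zero hq i
    have h4 := one_sub_pow_succ_ne_zero hq d
    field_simp
    ring

/-- The generating function of the `i`-element subsets of `{0, …, n - 1}` by their sum. -/
lemma sum_powersetCard_range_pow_sum {q : ℂ} (hq : ‖q‖ < 1) (n i : ℕ) :
    ∑ T ∈ Finset.powersetCard i (Finset.range n), q ^ (∑ x ∈ T, x)
      = q ^ (i.choose 2) * qbinom q n i := by
  induction n generalizing i with
  | zero =>
    rcases i with _ | i
    · simp [qbinom_zero_right hq]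
    · rw [Finset.powersetCard_eq_empty.mpr (by simp)]
      simp [qbinom]
  | succ n ih =>
    rcases i with _ | i
    · simp [qbinom_zero_right hq]
    · have hn : n ∉ Finset.range n := Finset.notMem_range_self
      have hmem : ∀ T ∈ Finset.powersetCard i (Finset.range n), n ∉ T := fun T hT h =>
        hn ((Finset.mem_powersetCard.mp hT).1 h)
      rw [Finset.range_add_one, Finset.powersetCard_succ_insert hn, Finset.sum_union, ih,
        Finset.sum_image, Finset.sum_congr rfl fun T hT => by
          rw [Finset.sum_insert (hmem T hT), pow_add], ← Finset.mul_sum, ih]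
      · rcases le_or_gt i n with hi | hi
        · rw [qbinom_succ_succ hq hi, Nat.choose_succ_succ' i 1, Nat.choose_one_right]
          have : q ^ n = q ^ i * q ^ (n - i) := by rw [← pow_add, Nat.add_sub_cancel' hi]
          rw [this]
          ring
        · have l1 : ¬ i + 1 ≤ n := by omega
          have l2 : ¬ i ≤ n := by omega
          simp [qbinom, l2, l1]
      · intro S hS T hT h
        rw [← Finset.erase_insert (hmem S hS), ← Finset.erase_insert (hmem T hT)]
        exact congrArg (fun U => U.erase n) h
      · refine Finset.disjoint_left.mpr fun T hT hT' => ?_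
        obtain ⟨U, -, rfl⟩ := Finset.mem_image.mp hT'
        exact hn ((Finset.mem_powersetCard.mp hT).1 (Finset.mem_insert_self n U))

lemma summable_pow_sum {q : ℂ} (hq : ‖q‖ < 1) :
    Summable fun T : Finset ℕ => q ^ (∑ x ∈ T, x) := by
  have h := summable_finsetProd_of_summable_norm (f := fun n : ℕ => q ^ n)
    (by simpa using summable_geometric_of_lt_one (norm_nonneg q) hq)
  exact h.congr fun T => Finset.prod_pow_eq_pow_sum T (fun x => x) q

open Filter Topology in
lemma tendsto_qbinom {q : ℂ} (hq : ‖q‖ < 1) (j : ℕ) :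
    Tendsto (fun n => qbinom q n j) atTop (𝓝 (qPoch q q j)⁻¹) := by
  rw [← tendsto_add_atTop_iff_nat j]
  have h : ∀ n, qbinom q (n + j) j
      = (∏ k ∈ Finset.range j, (1 - q * q ^ (n + k))) * (qPoch q q j)⁻¹ := by
    intro n
    have h1 := qPoch_ne_zero hq n
    have h2 : qPoch q q (n + j)
        = qPoch q q n * ∏ k ∈ Finset.range j, (1 - q * q ^ (n + k)) := Finset.prod_range_add _ _ _
    rw [qbinom, if_pos (Nat.le_add_left _ _), Nat.add_sub_cancel, h2]
    field_simp
  simp only [h]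
  have hp : ∀ k ∈ Finset.range j, Tendsto (fun n => 1 - q * q ^ (n + k)) atTop (𝓝 (1 : ℂ)) := by
    intro k _
    have := (tendsto_pow_atTop_nhds_zero_of_norm_lt_one hq).comp (tendsto_add_atTop_nat k)
    simpa using (this.const_mul q).const_sub 1
  simpa using (tendsto_finsetProd _ hp).mul_const (qPoch q q j)⁻¹

lemma summable_ite_card_pow_sum {q : ℂ} (hq : ‖q‖ < 1) (j : ℕ) :
    Summable fun T : Finset ℕ => if T.card = j then q ^ (∑ x ∈ T, x) else 0 := by
  classical
  refine ((summable_pow_sum hq).indicator {T : Finset ℕ | T.card = j}).congr fun T => ?_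
  simp [Set.indicator_apply]

open Filter Topology in
/-- Euler's generating function for the `j`-element sets of natural numbers by their sum. -/
lemma tsum_ite_card_pow_sum {q : ℂ} (hq : ‖q‖ < 1) (j : ℕ) :
    ∑' T : Finset ℕ, (if T.card = j then q ^ (∑ x ∈ T, x) else 0)
      = q ^ (j.choose 2) * (qPoch q q j)⁻¹ := by
  have hT : Tendsto (fun n => (Finset.range n).powerset) atTop atTop := by
    refine tendsto_atTop_finset_of_monotone (fun m n h => ?_) fun T => ?_
    · exact Finset.powerset_mono.mpr (Finset.range_mono h)
    · obtain ⟨n, hn⟩ := Finset.exists_nat_subset_range T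
      exact ⟨n, Finset.mem_powerset.mpr hn⟩
  have h1 := (summable_ite_card_pow_sum hq j).hasSum.comp hT
  refine tendsto_nhds_unique h1 (((tendsto_qbinom hq j).const_mul _).congr fun n => ?_)
  rw [← sum_powersetCard_range_pow_sum hq, Finset.powersetCard_eq_filter, Finset.sum_filter]
  rfl

/-- The finite sets of positive integers that contain their own cardinality. -/
abbrev RascoeSet : Type := {S : Finset ℕ // 0 ∉ S ∧ S.card ∈ S}

/-- The data that determine a Rascoe set `S` with `n + 1` elements: the elements above `n + 1`,
shifted down to `U`, and those below `n + 1`, shifted down to `L`. -/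
abbrev RascoeData (x : ℕ × Finset ℕ × Finset ℕ) : Prop :=
  x.2.2 ⊆ Finset.range x.1 ∧ x.2.1.card + x.2.2.card = x.1

/-- The set with lower part `L`, middle element `n + 1` and upper part `U`. -/
def rascoeGlue (x : ℕ × Finset ℕ × Finset ℕ) : Finset ℕ :=
  insert (x.1 + 1) (x.2.2.image (· + 1) ∪ x.2.1.image (· + (x.1 + 2)))

/-- The decomposition of a set around its cardinality. -/
def rascoeSplit (S : Finset ℕ) : ℕ × Finset ℕ × Finset ℕ :=
  (S.card - 1, (S.filter (S.card < ·)).image (· - (S.card + 1)),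
    (S.filter (· < S.card)).image (· - 1))

lemma sum_rascoeGlue {x : ℕ × Finset ℕ × Finset ℕ} (hx : x.2.2 ⊆ Finset.range x.1)
    (f : ℕ → ℕ) :
    ∑ k ∈ rascoeGlue x, f k
      = f (x.1 + 1) + (∑ k ∈ x.2.2, f (k + 1) + ∑ k ∈ x.2.1, f (k + (x.1 + 2))) := by
  have hL : ∀ k ∈ x.2.2, k < x.1 := fun k hk => Finset.mem_range.mp (hx hk)
  rw [rascoeGlue, Finset.sum_insert, Finset.sum_union, Finset.sum_image, Finset.sum_image]
  · intro a _ b _ h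
    simpa using h
  · intro a _ b _ h
    simpa using h
  · refine Finset.disjoint_left.mpr fun a ha hb => ?_
    obtain ⟨k, hk, rfl⟩ := Finset.mem_image.mp ha
    obtain ⟨l, -, h⟩ := Finset.mem_image.mp hb
    have := hL k hk
    omega
  · intro h
    rcases Finset.mem_union.mp h with h | h
    · obtain ⟨k, hk, h⟩ := Finset.mem_image.mp h
      have := hL k hk
      omega
    · obtain ⟨k, -, h⟩ := Finset.mem_image.mp h
      omega

lemma card_rascoeGlue {x : ℕ × Finset ℕ × Finset ℕ} (hx : RascoeData x) :
    (rascoeGlue x).card = x.1 + 1 := by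
  have h := sum_rascoeGlue hx.1 fun _ => 1
  have := hx.2
  simp only [Finset.sum_const, smul_eq_mul, mul_one] at h
  omega

lemma rascoeSplit_rascoeGlue {x : ℕ × Finset ℕ × Finset ℕ} (hx : RascoeData x) :
    rascoeSplit (rascoeGlue x) = x := by
  have hL : ∀ k ∈ x.2.2, k < x.1 := fun k hk => Finset.mem_range.mp (hx.1 hk)
  have hc := card_rascoeGlue hx
  obtain ⟨n, U, L⟩ := x
  simp only [rascoeSplit, hc]
  simp only [Prod.mk.injEq, rascoeGlue] at hL ⊢
  refine ⟨by omega, ?_, ?_⟩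
  · ext k
    simp only [Finset.mem_image, Finset.mem_filter, Finset.mem_insert, Finset.mem_union]
    constructor
    · rintro ⟨a, ⟨rfl | ⟨b, hb, rfl⟩ | ⟨b, hb, rfl⟩, h2⟩, rfl⟩
      · omega
      · have := hL b hb
        omega
      · simpa using hb
    · exact fun hk => ⟨k + (n + 2), ⟨Or.inr (Or.inr ⟨k, hk, rfl⟩), by omega⟩, by omega⟩
  · ext k
    simp only [Finset.mem_image, Finset.mem_filter, Finset.mem_insert, Finset.mem_union]
    constructor
    · rintro ⟨a, ⟨rfl | ⟨b, hb, rfl⟩ | ⟨b, hb, rfl⟩, h2⟩, rfl⟩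
      · omega
      · simpa using hb
      · omega
    · intro hk
      have := hL k hk
      exact ⟨k + 1, ⟨Or.inr (Or.inl ⟨k, hk, rfl⟩), by omega⟩, by omega⟩

lemma rascoeGlue_rascoeSplit {S : Finset ℕ} (h0 : 0 ∉ S) (hS : S.card ∈ S) :
    rascoeGlue (rascoeSplit S) = S := by
  have hpos : 0 < S.card := Finset.card_pos.mpr ⟨_, hS⟩
  ext k
  simp only [rascoeGlue, rascoeSplit, Finset.mem_image, Finset.mem_filter, Finset.mem_insert,
    Finset.mem_union]
  constructor
  · rintro (rfl | ⟨_, ⟨b, ⟨hb, hlt⟩, rfl⟩, rfl⟩ | ⟨_, ⟨b, ⟨hb, hlt⟩, rfl⟩, rfl⟩)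
    · rwa [Nat.sub_add_cancel hpos]
    · have hb0 : b ≠ 0 := fun h => h0 (h ▸ hb)
      rwa [Nat.sub_add_cancel (Nat.one_le_iff_ne_zero.mpr hb0)]
    · have : b - (S.card + 1) + (S.card - 1 + 2) = b := by omega
      rwa [this]
  · intro hk
    have hk0 : k ≠ 0 := fun h => h0 (h ▸ hk)
    rcases lt_trichotomy k S.card with h | h | h
    · exact Or.inr (Or.inl ⟨k - 1, ⟨k, ⟨hk, h⟩, rfl⟩, by omega⟩)
    · exact Or.inl (by omega)
    · exact Or.inr (Or.inr ⟨k - (S.card + 1), ⟨k, ⟨hk, h⟩, rfl⟩, by omega⟩)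

lemma rascoeData_rascoeSplit {S : Finset ℕ} (h0 : 0 ∉ S) (hS : S.card ∈ S) :
    RascoeData (rascoeSplit S) := by
  have hpos : 0 < S.card := Finset.card_pos.mpr ⟨_, hS⟩
  have hsub : (rascoeSplit S).2.2 ⊆ Finset.range (rascoeSplit S).1 := by
    intro k hk
    simp only [rascoeSplit, Finset.mem_image, Finset.mem_filter, Finset.mem_range] at hk ⊢
    obtain ⟨a, ⟨ha, hlt⟩, rfl⟩ := hk
    have ha0 : a ≠ 0 := fun h => h0 (h ▸ ha)
    omega
  refine ⟨hsub, ?_⟩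
  have h := sum_rascoeGlue hsub fun _ => 1
  rw [rascoeGlue_rascoeSplit h0 hS] at h
  simp only [Finset.sum_const, smul_eq_mul, mul_one] at h
  have h1 : (rascoeSplit S).1 = S.card - 1 := rfl
  omega

/-- A Rascoe set is determined by its parts below and above its cardinality. -/
def rascoeEquiv : {x : ℕ × Finset ℕ × Finset ℕ // RascoeData x} ≃ RascoeSet where
  toFun x := ⟨rascoeGlue x.1, by simp [rascoeGlue], by
    rw [card_rascoeGlue x.2]
    exact Finset.mem_insert_self _ _⟩
  invFun S := ⟨rascoeSplit S.1, rascoeData_rascoeSplit S.2.1 S.2.2⟩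
  left_inv x := Subtype.ext (rascoeSplit_rascoeGlue x.2)
  right_inv S := Subtype.ext (rascoeGlue_rascoeSplit S.2.1 S.2.2)

/-- Rascoe partitions of `N` correspond to Rascoe sets with sum `N`. -/
def rascoePartitionEquiv (N : ℕ) :
    {p : Nat.Partition N // p.parts.Nodup ∧ Multiset.card p.parts ∈ p.parts} ≃
      ((fun S : RascoeSet => ∑ k ∈ S.1, k) ⁻¹' {N}) where
  toFun p := ⟨⟨⟨p.1.parts, p.2.1⟩, fun h => (p.1.parts_pos h).ne' rfl, p.2.2⟩, by
    simp only [Set.mem_preimage, Set.mem_singleton_iff, Finset.sum, Multiset.map_id']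
    exact p.1.parts_sum⟩
  invFun S := ⟨⟨S.1.1.val, fun {i} hi => Nat.pos_of_ne_zero fun h => S.1.2.1 (h ▸ hi), by
    have := S.2
    simpa only [Set.mem_preimage, Set.mem_singleton_iff, Finset.sum, Multiset.map_id'] using this⟩,
    S.1.1.nodup, S.1.2.2⟩
  left_inv _ := rfl
  right_inv _ := rfl

lemma rascoeA_zero : rascoeA 0 = 0 := by
  have : IsEmpty {p : Nat.Partition 0 // p.parts.Nodup ∧ Multiset.card p.parts ∈ p.parts} := by
    refine ⟨fun p => ?_⟩
    have h := p.2.2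
    rw [Subsingleton.elim p.1 default] at h
    simp at h
  exact Nat.card_of_isEmpty

lemma summable_rascoeSet {q : ℂ} (hq : ‖q‖ < 1) :
    Summable fun S : RascoeSet => q ^ (∑ k ∈ S.1, k) :=
  (summable_pow_sum hq).comp_injective Subtype.val_injective

lemma tsum_rascoeA {q : ℂ} (hq : ‖q‖ < 1) :
    ∑' N : ℕ, (rascoeA (N + 1) : ℂ) * q ^ (N + 1) = ∑' S : RascoeSet, q ^ (∑ k ∈ S.1, k) := by
  have h := (summable_rascoeSet hq).hasSum.tsum_fiberwise fun S : RascoeSet => ∑ k ∈ S.1, k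
  have hN : ∀ N : ℕ, (∑' S : (fun S : RascoeSet => ∑ k ∈ S.1, k) ⁻¹' {N}, q ^ (∑ k ∈ S.1.1, k))
      = (rascoeA N : ℂ) * q ^ N := by
    intro N
    rw [tsum_congr fun S : (fun S : RascoeSet => ∑ k ∈ S.1, k) ⁻¹' {N} =>
      congrArg (q ^ ·) (show ∑ k ∈ S.1.1, k = N from S.2), tsum_const,
      ← Nat.card_congr (rascoePartitionEquiv N), nsmul_eq_mul, rascoeA]
  simp only [hN] at h
  rw [← h.tsum_eq, h.summable.tsum_eq_zero_add, rascoeA_zero]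
  simp

lemma rascoe_exponent (j d : ℕ) :
    j + d + 1 + (d + j * (j + d + 2)) + (d.choose 2 + j.choose 2)
      = (j + d + 1) * (j + d + 2) / 2 + (j + 1) * j := by
  have h : (j + d + 1) * (j + d + 2) / 2 = (j + d + 2).choose 2 := by
    rw [Nat.choose_two_right, mul_comm]
    rfl
  rw [h]
  have : (((j + d + 1 + (d + j * (j + d + 2)) + (d.choose 2 + j.choose 2) : ℕ)) : ℚ)
      = (((j + d + 2).choose 2 + (j + 1) * j : ℕ) : ℚ) := by
    push_cast [Nat.cast_choose_two]
    ring
  exact_mod_cast this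

/-- The weight of the data of a Rascoe set, extended by zero. -/
noncomputable def rascoeWeight (q : ℂ) (x : ℕ × Finset ℕ × Finset ℕ) : ℂ :=
  if RascoeData x then q ^ (∑ k ∈ rascoeGlue x, k) else 0

lemma rascoeWeight_eq_indicator (q : ℂ) :
    rascoeWeight q = Set.indicator {x | RascoeData x} fun x => q ^ (∑ k ∈ rascoeGlue x, k) := by
  ext x
  simp [rascoeWeight, Set.indicator_apply]

lemma summable_rascoeWeight {q : ℂ} (hq : ‖q‖ < 1) : Summable (rascoeWeight q) := by
  have h : Summable fun x : {x // RascoeData x} => q ^ (∑ k ∈ rascoeGlue x.1, k) :=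
    ((summable_rascoeSet hq).comp_injective rascoeEquiv.injective).congr fun _ => rfl
  rw [rascoeWeight_eq_indicator]
  exact summable_subtype_iff_indicator.mp h

lemma tsum_rascoeWeight (q : ℂ) :
    ∑' x, rascoeWeight q x = ∑' S : RascoeSet, q ^ (∑ k ∈ S.1, k) := by
  rw [← rascoeEquiv.tsum_eq, rascoeWeight_eq_indicator, ← tsum_subtype]
  rfl

/-- Summation over the lower parts. -/
lemma tsum_rascoeWeight_lower {q : ℂ} (hq : ‖q‖ < 1) (n : ℕ) (U : Finset ℕ) :
    ∑' L, rascoeWeight q (n, U, L)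
      = ∑ j ∈ Finset.range (n + 1), q ^ (n + 1 + (n - j + j * (n + 2)) + (n - j).choose 2)
          * qbinom q n j * (if U.card = j then q ^ (∑ x ∈ U, x) else 0) := by
  simp only [mul_ite, mul_zero, Finset.sum_ite_eq, Finset.mem_range]
  split_ifs with hU
  · have hU' : U.card ≤ n := by omega
    rw [tsum_eq_sum (s := Finset.powersetCard (n - U.card) (Finset.range n))]
    · rw [← qbinom_symm q hU', pow_add, mul_assoc (q ^ _) (q ^ _),
        ← sum_powersetCard_range_pow_sum hq, Finset.mul_sum, Finset.sum_mul]
      refine Finset.sum_congr rfl fun L hL => ?_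
      obtain ⟨h1, h2⟩ := Finset.mem_powersetCard.mp hL
      have hd : RascoeData (n, U, L) := ⟨h1, by dsimp only; omega⟩
      rw [rascoeWeight, if_pos hd, sum_rascoeGlue h1,
        ← pow_add, ← pow_add]
      simp only [Finset.sum_add_distrib, Finset.sum_const, smul_eq_mul, mul_one, h2]
      congr 1
      ring
    · intro L hL
      refine if_neg fun h => hL ?_
      have := h.2
      dsimp only at this
      exact Finset.mem_powersetCard.mpr ⟨h.1, by omega⟩
  · refine (tsum_congr fun L => ?_).trans tsum_zero
    refine if_neg fun h => hU ?_
    have := h.2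
    dsimp only at this
    omega

theorem rascoe_gen_fun (q : ℂ) (hq : ‖q‖ < 1) :
    ∑' N : ℕ, (rascoeA (N + 1) : ℂ) * q ^ (N + 1)
      = ∑' n : ℕ, q ^ ((n + 1) * (n + 2) / 2) *
          ∑ m ∈ Finset.range (n + 1),
            qbinom q n m * q ^ ((m + 1) * m) / qPoch q q m := by
  have hs := summable_rascoeWeight hq
  rw [tsum_rascoeA hq, ← tsum_rascoeWeight, hs.tsum_prod]
  refine tsum_congr fun n => ?_
  rw [(hs.prod_factor n).tsum_prod]
  simp only [tsum_rascoeWeight_lower hq]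
  rw [Summable.tsum_finsetSum fun j _ => (summable_ite_card_pow_sum hq j).mul_left _,
    Finset.mul_sum]
  refine Finset.sum_congr rfl fun j hj => ?_
  rw [tsum_mul_left, tsum_ite_card_pow_sum hq]
  obtain ⟨d, rfl⟩ := Nat.exists_eq_add_of_le (Finset.mem_range_succ_iff.mp hj)
  have h := congrArg (q ^ ·) (rascoe_exponent j d)
  simp only [pow_add _ (_ / 2), ← add_assoc _ (d.choose 2), pow_add _ _ (j.choose 2)] at h
  rw [Nat.add_sub_cancel_left, div_eq_mul_inv]
  linear_combination (qbinom q (j + d) j * (qPoch q q j)⁻¹) * h
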